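/- Let t be a squarefree positive integer coprime to 6 with exactly m distinct prime factors. Then, as real numbers, ∑_{1 ≤ s < t, s ≡ 23 (mod 24)} ∑_{d ∣ t} μ(d) ψ_d(s) ≥ t/24 − 1 − 2^{m+1} √(24t) · log(24t). -/

import Mathlib

/-- `psi d s = ∏_{p ∣ d prime} (-p | s)`, a product of Jacobi symbols;
by convention `psi 1 s = 1` (empty product). -/
def psi (d : ℕ) (s : ℕ) : ℤ :=
  ∏ p ∈ d.primeFactors, jacobiSym (-(p : ℤ)) s

open ZMod in
lemma aux_dft (N : ℕ) [NeZero N] (χ : ZMod N → ℂ) (hmul : ∀ a b, χ (a * b) = χ a * χ b)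
    (h1 : χ 1 = 1) (hunit : ∀ u : (ZMod N)ˣ, χ u = 1 ∨ χ u = -1)
    (hnon : ∀ a : ZMod N, ¬ IsUnit a → χ a = 0 ∧ ∃ u : (ZMod N)ˣ, χ u = -1 ∧ (u : ZMod N) * a = a) :
    (∀ a, ¬ IsUnit a → ZMod.dft χ a = 0) ∧ ∀ a, ‖ZMod.dft χ a‖ ≤ Real.sqrt N := by
  have hF : ∀ (u : (ZMod N)ˣ) k, χ u * dft χ k = dft χ (u⁻¹.val * k) := by
    intro u k
    rw [← dft_comp_unitMul]
    simp only [hmul, dft_const_mul]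
  have hn : ∀ a, ¬ IsUnit a → ZMod.dft χ a = 0 := by
    intro a ha
    obtain ⟨-, u, hu, hua⟩ := hnon a ha
    have h := hF u a
    have h2 : u⁻¹.val * a = a := by
      conv_lhs => rw [← hua]
      simp
    rw [h2, hu] at h
    linear_combination (-1/2) * h
  have hall : ∀ a, dft χ a = χ a * dft χ 1 := by
    intro a
    by_cases ha : IsUnit a
    · obtain ⟨u, rfl⟩ := ha
      have h := hF u u
      rw [Units.inv_mul] at h
      rw [← h]
      rcases hunit u with h | h <;> rw [h] <;> ring
    · rw [hn a ha, (hnon a ha).1, zero_mul]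
  have hsq : dft χ (-1) * dft χ 1 = N := by
    have h := congrFun (dft_dft χ) (-1)
    have e : dft χ = fun a => χ a * dft χ 1 := funext hall
    conv_lhs at h => rw [e]
    rw [dft_mul_const] at h
    simpa [h1] using h
  have hpm : ∀ u : (ZMod N)ˣ, ‖χ u‖ = 1 := by
    intro u; rcases hunit u with h | h <;> simp [h]
  have hm1 : ‖χ (-1)‖ = 1 := by simpa using hpm (-1)
  have hnorm : ‖dft χ 1‖ = Real.sqrt N := by
    rw [hall] at hsq
    have := congrArg norm hsq
    rw [norm_mul, norm_mul, hm1, one_mul, Complex.norm_natCast] at this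
    rw [← this, Real.sqrt_mul_self (norm_nonneg _)]
  refine ⟨hn, fun a => ?_⟩
  by_cases ha : IsUnit a
  · obtain ⟨u, rfl⟩ := ha
    rw [hall, norm_mul, hpm, one_mul, hnorm]
  · rw [hn a ha]; simp

lemma aux_sin (N j : ℕ) (h0 : 0 < j) (hj : j < N) :
    2 * (min j (N - j) : ℕ) / (N : ℝ) ≤ Real.sin (Real.pi * j / N) := by
  have hN : (0 : ℝ) < N := by exact_mod_cast h0.trans hj
  have key : ∀ i : ℕ, 2 * i ≤ N → 2 * (i : ℝ) / N ≤ Real.sin (Real.pi * i / N) := by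
    intro i hi
    have hi' : 2 * (i : ℝ) ≤ N := by exact_mod_cast hi
    have := Real.mul_le_sin (x := Real.pi * i / N) (by positivity) (by
      rw [div_le_div_iff₀ hN two_pos]; nlinarith [Real.pi_pos])
    convert this using 1
    field_simp
  rcases le_total (2 * j) N with h | h
  · rw [min_eq_left (by omega)]; exact key j h
  · rw [min_eq_right (by omega)]
    have := key (N - j) (by omega)
    refine this.trans (le_of_eq ?_)
    rw [← Real.sin_pi_sub]
    congr 1
    push_cast [hj.le]
    field_simp
    ring

lemma aux_geom (N : ℕ) [NeZero N] (j : ZMod N) (hj : j ≠ 0) (a : ZMod N) (K : ℕ) :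
    ‖∑ k ∈ Finset.range K, (ZMod.stdAddChar (j * ((k : ZMod N) + a)) : ℂ)‖ ≤
      (N : ℝ) / 2 * (1 / (j.val : ℝ) + 1 / ((N - j.val : ℕ) : ℝ)) := by
  have hjv : 0 < j.val := Nat.pos_of_ne_zero (by simpa using hj)
  have hjN := ZMod.val_lt j
  have hN : (0 : ℝ) < N := by exact_mod_cast hjv.trans hjN
  have hz : (ZMod.stdAddChar j : ℂ) = Complex.exp (Complex.I * ((2 * (Real.pi * j.val / N) : ℝ) : ℂ)) := by
    have := ZMod.stdAddChar_coe (N := N) j.val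
    rw [Int.cast_natCast, ZMod.natCast_zmod_val] at this
    rw [this]; congr 1; push_cast; ring
  have hz1 : ‖(ZMod.stdAddChar j : ℂ) - 1‖ ≥ 4 * (min j.val (N - j.val) : ℕ) / (N : ℝ) := by
    rw [hz, Complex.norm_exp_I_mul_ofReal_sub_one, mul_div_cancel_left₀ _ two_ne_zero]
    have := aux_sin N j.val hjv hjN
    rw [Real.norm_eq_abs]
    refine le_trans ?_ (le_abs_self _)
    rw [mul_div_assoc] at this ⊢
    linarith
  have hmin : (0 : ℝ) < (min j.val (N - j.val) : ℕ) := by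
    exact_mod_cast (by omega : 0 < min j.val (N - j.val))
  have hpos : (0:ℝ) < 4 * (min j.val (N - j.val) : ℕ) / (N : ℝ) := by positivity
  have hne : (ZMod.stdAddChar j : ℂ) ≠ 1 := by
    intro h; rw [h] at hz1; simp at hz1; simp at hpos; linarith
  have hzn : ∀ x : ZMod N, ‖(ZMod.stdAddChar x : ℂ)‖ = 1 := fun x => by
    rw [ZMod.stdAddChar_apply]; exact Circle.norm_coe _
  have e : ∀ k : ℕ, (ZMod.stdAddChar (j * ((k : ZMod N) + a)) : ℂ) =
      (ZMod.stdAddChar j : ℂ) ^ k * ZMod.stdAddChar (j * a) := by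
    intro k
    rw [mul_add, AddChar.map_add_eq_mul, ← AddChar.map_nsmul_eq_pow, nsmul_eq_mul, mul_comm j]
  simp_rw [e]
  rw [← Finset.sum_mul, norm_mul, hzn, mul_one, geom_sum_eq hne, norm_div]
  have hnum : ‖(ZMod.stdAddChar j : ℂ) ^ K - 1‖ ≤ 2 := by
    refine (norm_sub_le _ _).trans ?_
    rw [norm_pow, hzn]; norm_num
  calc _ ≤ 2 / (4 * (min j.val (N - j.val) : ℕ) / (N : ℝ)) := by
          apply div_le_div₀ two_pos.le hnum hpos hz1
    _ = (N : ℝ) / 2 * (1 / (min j.val (N - j.val) : ℕ)) := by field_simp; norm_num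
    _ ≤ _ := by
      gcongr
      rcases le_total j.val (N - j.val) with h | h
      · rw [min_eq_left h]; simp
      · rw [min_eq_right h]; exact le_add_of_nonneg_left (by positivity)

lemma aux_harm (N : ℕ) (hN : 0 < N) :
    ∑ j ∈ Finset.Ico 1 N, (1 / (j : ℝ) + 1 / ((N - j : ℕ) : ℝ)) ≤ 2 * (1 + Real.log N) := by
  have h1 : ∑ j ∈ Finset.Ico 1 N, 1 / (j : ℝ) ≤ 1 + Real.log N := by
    refine le_trans ?_ (harmonic_le_one_add_log N)
    rw [harmonic_eq_sum_Icc]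
    push_cast
    simp only [one_div]
    apply Finset.sum_le_sum_of_subset_of_nonneg
    · intro x; simp; omega
    · intros; positivity
  have h2 : ∑ j ∈ Finset.Ico 1 N, 1 / ((N - j : ℕ) : ℝ) = ∑ j ∈ Finset.Ico 1 N, 1 / (j : ℝ) := by
    refine Finset.sum_bij' (fun j _ => N - j) (fun j _ => N - j) ?_ ?_ ?_ ?_ ?_ <;>
      simp <;> omega
  rw [Finset.sum_add_distrib, h2]; linarith

open ZMod in
lemma aux_pv (N : ℕ) [NeZero N] (hN : 1 < N) (χ : ZMod N → ℂ) (h0 : dft χ 0 = 0)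
    (hb : ∀ a, ‖ZMod.dft χ a‖ ≤ Real.sqrt N) (a : ZMod N) (K : ℕ) :
    ‖∑ k ∈ Finset.range K, χ ((k : ZMod N) + a)‖ ≤ Real.sqrt N * (1 + Real.log N) := by
  have hNp : (0:ℝ) < N := by exact_mod_cast (by omega : 0 < N)
  have e : ∀ x, χ x = (N : ℂ)⁻¹ * ∑ j : ZMod N, stdAddChar (j * x) * dft χ j := by
    intro x
    have := invDFT_apply (dft χ) x
    simpa using this
  have e2 : ∑ k ∈ Finset.range K, χ ((k : ZMod N) + a) =
     (N : ℂ)⁻¹ * ∑ j : ZMod N, (∑ k ∈ Finset.range K, (stdAddChar (j * ((k : ZMod N) + a)) : ℂ)) * dft χ j := by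
    simp_rw [e, ← Finset.mul_sum]
    rw [Finset.sum_comm]
    simp_rw [Finset.sum_mul]
  rw [e2, norm_mul, norm_inv, Complex.norm_natCast]
  let g : ℕ → ℝ := fun j => if j = 0 then 0 else
    (N : ℝ) / 2 * (1 / (j : ℝ) + 1 / ((N - j : ℕ) : ℝ)) * Real.sqrt N
  have hs : ‖∑ j : ZMod N, (∑ k ∈ Finset.range K, (stdAddChar (j * ((k : ZMod N) + a)) : ℂ)) * dft χ j‖
      ≤ ∑ j : ZMod N, g j.val := by
    refine (norm_sum_le _ _).trans (Finset.sum_le_sum fun j _ => ?_)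
    by_cases hj : j = 0
    · subst hj; rw [h0]; simp [g]
    · have : j.val ≠ 0 := by simpa using hj
      simp only [g, this, if_false]
      rw [norm_mul]
      exact mul_le_mul (aux_geom N j hj a K) (hb j) (norm_nonneg _) (by positivity)
  have hs2 : ∑ j : ZMod N, g j.val = ∑ j ∈ Finset.range N, g j := by
    refine Finset.sum_bij' (fun j _ => j.val) (fun j _ => (j : ZMod N)) ?_ ?_ ?_ ?_ ?_
    · intro j _; simpa using ZMod.val_lt j
    · simp
    · simp
    · intro j hj; simp at hj; simp [ZMod.val_cast_of_lt hj]
    · simp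
  have hs3 : ∑ j ∈ Finset.range N, g j ≤ N * (Real.sqrt N * (1 + Real.log N)) := by
    rw [Finset.range_eq_Ico, Finset.sum_eq_sum_Ico_succ_bot (by omega)]
    have : ∑ j ∈ Finset.Ico 1 N, g j = (N : ℝ) / 2 * Real.sqrt N *
      ∑ j ∈ Finset.Ico 1 N, (1 / (j : ℝ) + 1 / ((N - j : ℕ) : ℝ)) := by
      rw [Finset.mul_sum]
      refine Finset.sum_congr rfl fun j hj => ?_
      have : j ≠ 0 := by simp at hj; omega
      simp only [g, this, if_false]; ring
    simp only [zero_add]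
    rw [this]
    have := mul_le_mul_of_nonneg_left (aux_harm N (by omega))
      (by positivity : 0 ≤ (N : ℝ) / 2 * Real.sqrt N)
    simp only [g, if_true]
    linarith
  rw [inv_mul_le_iff₀ hNp]
  linarith

/-- The Jacobi symbol as a function on `ZMod d`. -/
noncomputable def jchi (d : ℕ) (x : ZMod d) : ℂ := ((jacobiSym (x.val : ℤ) d : ℤ) : ℂ)

lemma jchi_natCast (d n : ℕ) : jchi d (n : ZMod d) = ((jacobiSym (n : ℤ) d : ℤ) : ℂ) := by
  unfold jchi
  rw [ZMod.val_natCast, Int.natCast_mod, ← jacobiSym.mod_left]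

lemma jchi_mul (d : ℕ) [NeZero d] (a b : ZMod d) : jchi d (a * b) = jchi d a * jchi d b := by
  rw [← ZMod.natCast_zmod_val a, ← ZMod.natCast_zmod_val b, ← Nat.cast_mul]
  simp only [jchi_natCast]
  push_cast [jacobiSym.mul_left]
  rfl

lemma exists_nonres (p : ℕ) (hp : p.Prime) (h2 : p ≠ 2) : ∃ r : ℕ, jacobiSym (r : ℤ) p = -1 := by
  have := Fact.mk hp
  obtain ⟨a, ha⟩ := quadraticChar_exists_neg_one (F := ZMod p) (by rwa [ZMod.ringChar_zmod_n])
  refine ⟨a.val, ?_⟩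
  rw [← jacobiSym.legendreSym.to_jacobiSym, legendreSym]
  simpa using ha

lemma jchi_props (d : ℕ) [NeZero d] (hd : Squarefree d) (hodd : Odd d) :
    jchi d 1 = 1 ∧ (∀ u : (ZMod d)ˣ, jchi d u = 1 ∨ jchi d u = -1) ∧
    (∀ a : ZMod d, ¬ IsUnit a → jchi d a = 0 ∧
      ∃ u : (ZMod d)ˣ, jchi d u = -1 ∧ (u : ZMod d) * a = a) := by
  refine ⟨?_, ?_, ?_⟩
  · have := jchi_natCast d 1
    simpa [jacobiSym.one_left] using this
  · intro u
    have h : Int.gcd ((u : ZMod d).val : ℤ) d = 1 := ZMod.val_coe_unit_coprime u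
    unfold jchi
    rcases jacobiSym.eq_one_or_neg_one h with h | h <;> rw [h] <;> simp
  · intro a ha
    have hg : Nat.gcd a.val d ≠ 1 := by
      intro h
      apply ha
      rw [← ZMod.natCast_zmod_val a]
      exact (ZMod.isUnit_iff_coprime _ _).2 h
    constructor
    · unfold jchi
      rw [jacobiSym.eq_zero_iff_not_coprime.2 (by rw [Int.gcd_natCast_natCast]; exact hg)]; simp
    · obtain ⟨p, hp, hpg⟩ := Nat.exists_prime_and_dvd hg
      have hpa : p ∣ a.val := hpg.trans (Nat.gcd_dvd_left _ _)
      obtain ⟨q, rfl⟩ : p ∣ d := hpg.trans (Nat.gcd_dvd_right _ _)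
      have hcop : Nat.Coprime p q := Nat.coprime_of_squarefree_mul hd
      have hpodd : Odd p := (Nat.odd_mul.1 hodd).1
      have hq0 : q ≠ 0 := by rintro rfl; simp at hd
      obtain ⟨r, hr⟩ := exists_nonres p hp (by rintro rfl; exact absurd hpodd (by decide))
      obtain ⟨n, hn1, hn2⟩ := Nat.chineseRemainder hcop r 1
      have hJ : jacobiSym (n : ℤ) (p * q) = -1 := by
        rw [jacobiSym.mul_right' _ hp.ne_zero hq0]
        have e1 : jacobiSym (n : ℤ) p = jacobiSym (r : ℤ) p :=
          jacobiSym.mod_left' (by exact_mod_cast hn1)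
        have e2 : jacobiSym (n : ℤ) q = jacobiSym (1 : ℤ) q :=
          jacobiSym.mod_left' (by exact_mod_cast hn2)
        rw [e1, e2, hr, jacobiSym.one_left]; rfl
      have hnc : Nat.Coprime n (p * q) := by
        by_contra h
        have : jacobiSym (n : ℤ) (p * q) = 0 :=
          jacobiSym.eq_zero_iff_not_coprime.2 (by rw [Int.gcd_natCast_natCast]; exact h)
        omega
      refine ⟨ZMod.unitOfCoprime n hnc, ?_, ?_⟩
      · rw [ZMod.coe_unitOfCoprime, jchi_natCast, hJ]; simp
      · rw [ZMod.coe_unitOfCoprime]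
        conv_lhs => rw [← ZMod.natCast_zmod_val a]
        conv_rhs => rw [← ZMod.natCast_zmod_val a]
        rw [← sub_eq_zero]
        have h1 : (((p * q : ℕ) : ℤ)) ∣ (n : ℤ) * a.val - a.val := by
          have h2 : (q : ℤ) ∣ (n : ℤ) - 1 := by
            have := (Nat.modEq_iff_dvd.1 hn2.symm)
            simpa using this
          have h3 : (p : ℤ) ∣ a.val := by exact_mod_cast hpa
          have := mul_dvd_mul h3 h2
          have e : (n : ℤ) * a.val - a.val = a.val * (n - 1) := by ring
          rw [Nat.cast_mul, e]; exact this
        have := (ZMod.intCast_zmod_eq_zero_iff_dvd _ (p * q)).2 h1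
        push_cast at this
        simpa using this

lemma jacobi_sum_bound (d K : ℕ) (hd : Squarefree d) (h6 : Nat.Coprime d 6) (h1 : 1 < d) :
    |((∑ k ∈ Finset.range K, jacobiSym ((24 * k + 23 : ℕ) : ℤ) d : ℤ) : ℝ)| ≤
      Real.sqrt d * (1 + Real.log d) := by
  have : NeZero d := ⟨by omega⟩
  have h2 : Nat.Coprime d 2 := h6.coprime_dvd_right (by norm_num)
  have h3 : Nat.Coprime d 3 := h6.coprime_dvd_right (by norm_num)
  have hodd : Odd d := Nat.Coprime.odd_of_right h2
  have h24 : Nat.Coprime 24 d := by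
    have : Nat.Coprime d (2 ^ 3 * 3) := (h2.pow_right 3).mul_right h3
    exact this.symm
  obtain ⟨p1, p2, p3⟩ := jchi_props d hd hodd
  obtain ⟨q1, q2⟩ := aux_dft d (jchi d) (jchi_mul d) p1 p2 p3
  have : Fact (1 < d) := ⟨h1⟩
  have h0 := q1 0 not_isUnit_zero
  set u := ZMod.unitOfCoprime 24 h24 with hu
  have hu24 : (u : ZMod d) = 24 := by rw [hu, ZMod.coe_unitOfCoprime]; simp
  have e : ((∑ k ∈ Finset.range K, jacobiSym ((24 * k + 23 : ℕ) : ℤ) d : ℤ) : ℂ) =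
      jchi d u * ∑ k ∈ Finset.range K, jchi d ((k : ZMod d) + (u⁻¹ : (ZMod d)ˣ) * 23) := by
    rw [Finset.mul_sum]
    push_cast
    refine Finset.sum_congr rfl fun k _ => ?_
    rw [← jchi_mul, mul_add, Units.mul_inv_cancel_left]
    have := jchi_natCast d (24 * k + 23)
    push_cast at this
    rw [hu24, this]
  have hb := aux_pv d h1 (jchi d) h0 q2 ((u⁻¹ : (ZMod d)ˣ) * 23) K
  have hun : ‖jchi d u‖ = 1 := by rcases p2 u with h | h <;> simp [h]
  have := congrArg norm e
  rw [norm_mul, hun, one_mul, Complex.norm_intCast] at this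
  rw [this]; exact hb

lemma jacobi_prod (a : ℤ) (S : Finset ℕ) (hS : ∀ p ∈ S, p ≠ 0) :
    jacobiSym a (∏ p ∈ S, p) = ∏ p ∈ S, jacobiSym a p := by
  induction S using Finset.induction_on with
  | empty => simp
  | insert p S hp ih =>
    rw [Finset.prod_insert hp, Finset.prod_insert hp, jacobiSym.mul_right' _ (hS p (by simp)), ih]
    · exact fun q hq => hS q (by simp [hq])
    · exact Finset.prod_ne_zero_iff.2 fun q hq => hS q (by simp [hq])

lemma psi_eq (d : ℕ) (hd : Squarefree d) (hodd : Odd d) : ∃ ε : ℤ, |ε| = 1 ∧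
    ∀ s : ℕ, s % 24 = 23 → psi d s = ε * jacobiSym (s : ℤ) d := by
  refine ⟨∏ p ∈ d.primeFactors, (-(-1) ^ (p / 2)), ?_, ?_⟩
  · rw [Finset.abs_prod]
    exact Finset.prod_eq_one fun p _ => by simp
  · intro s hs
    have e : jacobiSym (s : ℤ) d = ∏ p ∈ d.primeFactors, jacobiSym (s : ℤ) p := by
      conv_lhs => rw [← Nat.prod_primeFactors_of_squarefree hd]
      exact jacobi_prod _ _ fun p hp => (Nat.prime_of_mem_primeFactors hp).ne_zero
    rw [e, psi, ← Finset.prod_mul_distrib]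
    refine Finset.prod_congr rfl fun p hp => ?_
    have hpo : Odd p := hodd.of_dvd_nat (Nat.dvd_of_mem_primeFactors hp)
    have hso : Odd s := Nat.odd_iff.2 (by omega)
    rw [jacobiSym.neg _ hso, ZMod.χ₄_nat_three_mod_four (by omega),
      jacobiSym.quadratic_reciprocity hpo hso, pow_mul]
    have : Odd (s / 2) := Nat.odd_iff.2 (by omega)
    rw [← pow_mul, mul_comm (p / 2), pow_mul, this.neg_one_pow]
    ring

lemma filter_sum (t : ℕ) (F : ℕ → ℤ) :
    ∑ s ∈ (Finset.range t).filter (fun s => s % 24 = 23), F s =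
      ∑ k ∈ Finset.range (t / 24), F (24 * k + 23) := by
  refine Finset.sum_bij' (fun s _ => s / 24) (fun k _ => 24 * k + 23) ?_ ?_ ?_ ?_ ?_
  · intro s hs; simp at hs ⊢; omega
  · intro s hs; simp at hs ⊢; omega
  · intro s hs; simp at hs ⊢; omega
  · intro s hs; omega
  · intro s hs; simp at hs ⊢; congr 1; omega

/-- Polya–Vinogradov lower bound: for squarefree `t` coprime to `6` with exactly `m` prime
factors,
`∑_{1 ≤ s < t, s ≡ 23 (24)} ∑_{d ∣ t} μ(d) ψ_d(s) ≥ t/24 - 1 - 2^{m+1} √(24t) log(24t)`. -/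
theorem moebius_psi_sum_lower_bound (t m : ℕ) (ht : Squarefree t) (h6 : Nat.Coprime t 6)
    (hm : t.primeFactors.card = m) :
    ((∑ s ∈ (Finset.range t).filter (fun s => s % 24 = 23),
        ∑ d ∈ t.divisors, (ArithmeticFunction.moebius d : ℤ) * psi d s : ℤ) : ℝ) ≥
      (t : ℝ) / 24 - 1 - 2 ^ (m + 1) * Real.sqrt (24 * t) * Real.log (24 * t) := by
  have ht0 : t ≠ 0 := ht.ne_zero
  have ht1 : (1 : ℝ) ≤ t := by exact_mod_cast Nat.pos_of_ne_zero ht0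
  have hcard : t.divisors.card = 2 ^ m := by
    rw [Nat.card_divisors ht0, ← hm]
    refine Finset.prod_eq_pow_card fun p hp => ?_
    rw [Nat.factorization_eq_one_of_squarefree ht (Nat.prime_of_mem_primeFactors hp)
      (Nat.dvd_of_mem_primeFactors hp)]
  set B := Real.sqrt (24 * t) * Real.log (24 * t) with hB
  have hlog : 0 ≤ Real.log (24 * t) := Real.log_nonneg (by linarith)
  have hB0 : 0 ≤ B := mul_nonneg (Real.sqrt_nonneg _) hlog
  rw [Finset.sum_comm]
  have hterm : ∀ d ∈ t.divisors.erase 1, -B ≤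
      ((∑ s ∈ (Finset.range t).filter (fun s => s % 24 = 23),
        (ArithmeticFunction.moebius d : ℤ) * psi d s : ℤ) : ℝ) := by
    intro d hd
    rw [Finset.mem_erase, Nat.mem_divisors] at hd
    obtain ⟨hd1, hdt, -⟩ := hd
    have hd0 : 0 < d := Nat.pos_of_dvd_of_pos hdt (Nat.pos_of_ne_zero ht0)
    have hsq := ht.squarefree_of_dvd hdt
    have h6' : Nat.Coprime d 6 := h6.coprime_dvd_left hdt
    have hodd : Odd d :=
      Nat.Coprime.odd_of_right (h6'.coprime_dvd_right (by norm_num : 2 ∣ 6))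
    obtain ⟨ε, hε, hpsi⟩ := psi_eq d hsq hodd
    rw [filter_sum]
    have e : ∑ k ∈ Finset.range (t / 24), (ArithmeticFunction.moebius d : ℤ) * psi d (24 * k + 23)
        = (ArithmeticFunction.moebius d * ε) *
          ∑ k ∈ Finset.range (t / 24), jacobiSym ((24 * k + 23 : ℕ) : ℤ) d := by
      rw [Finset.mul_sum]
      refine Finset.sum_congr rfl fun k _ => ?_
      rw [hpsi _ (by omega)]; ring
    have hb := jacobi_sum_bound d (t / 24) hsq h6' (by omega)
    have hμ : |((ArithmeticFunction.moebius d * ε : ℤ) : ℝ)| ≤ 1 := by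
      have : |ArithmeticFunction.moebius d * ε| ≤ 1 := by
        rw [abs_mul, hε, mul_one]; exact ArithmeticFunction.abs_moebius_le_one
      exact_mod_cast this
    have hdt' : (d : ℝ) ≤ t := by exact_mod_cast Nat.le_of_dvd (Nat.pos_of_ne_zero ht0) hdt
    have hd0' : (0 : ℝ) < d := by exact_mod_cast hd0
    have hlog2 : 1 + Real.log d ≤ Real.log (24 * t) := by
      have : Real.log (24 * d) = Real.log 24 + Real.log d := Real.log_mul (by norm_num) hd0'.ne'
      have h24 : 1 ≤ Real.log 24 := by
        rw [Real.le_log_iff_exp_le (by norm_num)]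
        linarith [Real.exp_one_lt_d9]
      have : Real.log (24 * d) ≤ Real.log (24 * t) :=
        Real.log_le_log (by positivity) (by linarith)
      linarith
    have hbB : Real.sqrt d * (1 + Real.log d) ≤ B := by
      refine mul_le_mul (Real.sqrt_le_sqrt (by linarith)) hlog2 ?_ (Real.sqrt_nonneg _)
      have : 0 ≤ Real.log d := Real.log_nonneg (by exact_mod_cast hd0)
      linarith
    rw [e, Int.cast_mul]
    refine neg_le_of_abs_le ?_
    rw [abs_mul]
    calc _ ≤ 1 * (Real.sqrt d * (1 + Real.log d)) :=
          mul_le_mul hμ hb (abs_nonneg _) zero_le_one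
      _ ≤ B := by linarith
  have hone : (t : ℝ) / 24 - 1 ≤ ((∑ s ∈ (Finset.range t).filter (fun s => s % 24 = 23),
        (ArithmeticFunction.moebius 1 : ℤ) * psi 1 s : ℤ) : ℝ) := by
    rw [filter_sum]
    have : (t : ℝ) ≤ 24 * ((t / 24 : ℕ) : ℝ) + 24 := by
      exact_mod_cast (by omega : t ≤ 24 * (t / 24) + 24)
    have e : ∑ k ∈ Finset.range (t / 24), (ArithmeticFunction.moebius 1 : ℤ) * psi 1 (24 * k + 23)
        = ((t / 24 : ℕ) : ℤ) := by simp [psi]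
    rw [e, Int.cast_natCast]
    linarith
  rw [← Finset.add_sum_erase _ _ (Nat.one_mem_divisors.2 ht0), Int.cast_add, Int.cast_sum (t.divisors.erase 1)]
  have hsum := Finset.card_nsmul_le_sum (t.divisors.erase 1) _ _ hterm
  rw [nsmul_eq_mul] at hsum
  have hc : ((t.divisors.erase 1).card : ℝ) ≤ 2 ^ (m + 1) := by
    have h1 : (t.divisors.erase 1).card ≤ 2 ^ (m + 1) := by
      refine Finset.card_erase_le.trans ?_
      rw [hcard]; exact Nat.pow_le_pow_right two_pos (by omega)
    exact_mod_cast h1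
  have := mul_le_mul_of_nonneg_right hc hB0
  rw [mul_assoc, ← hB]
  linarith
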